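/- Let N ≥ 1, let W : ℝ^N → ℝ with W ∈ L^p(ℝ^N) + L^∞(ℝ^N) for some p ≥ 1 with p > N/4, and with negative part W⁻ ∈ L^q(ℝ^N) + L^∞(ℝ^N) for some q ≥ 1 with q ≥ N/2 (q > 1 if N = 2). Let u₀ ∈ H¹(ℝ^N), u₀ ≠ 0, and let u ∈ C_b(ℝ;H¹(ℝ^N)) ∩ C¹_b(ℝ;H⁻¹(ℝ^N)) be the solution of the Hartree equation i∂ₜu + Δu − (W∗|u|²)u = 0, u(0) = u₀, which satisfies conservation of charge and of the energy E(u₀) = (1/2)‖∇u₀‖²_{L²} + (1/4)∫_{ℝ^N}(W∗|u₀|²)(x)|u₀(x)|² dx. Then for every 0 < ε < ‖u₀‖_{L²(ℝ^N)}, with M₀ = 2‖u₀‖_{L²(ℝ^N)}‖∇u‖_{L^∞(ℝ;L²(ℝ^N))}/(‖u₀‖²_{L²(ℝ^N)} − ε²), one has for every c ∈ ℝ^N and r ∈ [2,∞]: liminf_{t→±∞} |t|^{N(1/2−1/r)} ‖u(t)‖_{L^r({|x−c| < M₀|t|})} ≥ ε · |B(0,M₀)|^{−(1/2−1/r)}.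 If moreover W ≥ 0, the same conclusion holds with M₀ = 2‖u₀‖_{L²(ℝ^N)}√(2E(u₀))/(‖u₀‖²_{L²(ℝ^N)} − ε²). -/

import Mathlib

noncomputable section

abbrev EucSp (N : ℕ) : Type := EuclideanSpace ℝ (Fin N)

/-- `W^{1,∞}(Ω;ℝ)`: bounded Lipschitz real-valued functions on `Ω`. -/
def IsW1inf {N : ℕ} (Ω : Set (EucSp N)) (a : EucSp N → ℝ) : Prop :=
  (∃ L : NNReal, LipschitzOnWith L a Ω) ∧ (∃ C : ℝ, ∀ x ∈ Ω, |a x| ≤ C)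

/-- A realization of the Sobolev space `H¹₀(Ω)` for a nonempty open set `Ω ⊆ ℝ^N`:
a complex normed space `H`, injectively embedded in `L²(Ω)`, with a gradient operator
valued in `L²(Ω;ℂ^N)`, carrying the `H¹` norm, in which the test functions `C_c^∞(Ω)`
are dense (with the gradient extending the classical one), and which is stable under
multiplication by `W^{1,∞}(Ω;ℝ)` functions. Its elements are the elements of `H¹₀(Ω)`. -/
structure DirichletSetting (N : ℕ) where
  Ω : Set (EucSp N)
  hopen : IsOpen Ω
  hne : Ω.Nonempty
  H : Type
  [normedAddCommGroup : NormedAddCommGroup H]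
  [normedSpace : NormedSpace ℂ H]
  toL2 : H →ₗ[ℂ] MeasureTheory.Lp ℂ 2 (MeasureTheory.volume.restrict Ω)
  toL2_injective : Function.Injective toL2
  grad : H →ₗ[ℂ] MeasureTheory.Lp (EuclideanSpace ℂ (Fin N)) 2 (MeasureTheory.volume.restrict Ω)
  norm_eq : ∀ u : H, ‖u‖ ^ 2 = ‖toL2 u‖ ^ 2 + ‖grad u‖ ^ 2
  dense_test : ∀ u : H, ∀ δ : ℝ, 0 < δ → ∃ (v : H) (φ : EucSp N → ℂ),
      ‖u - v‖ < δ ∧ ContDiff ℝ (⊤ : ℕ∞) φ ∧ HasCompactSupport φ ∧ tsupport φ ⊆ Ω ∧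
      Filter.EventuallyEq (MeasureTheory.ae (MeasureTheory.volume.restrict Ω)) (toL2 v) φ ∧
      Filter.EventuallyEq (MeasureTheory.ae (MeasureTheory.volume.restrict Ω)) (grad v)
        (fun x => (WithLp.equiv 2 (Fin N → ℂ)).symm
          (fun j => fderiv ℝ φ x (EuclideanSpace.single j (1 : ℝ))))
  smul_W1inf_mem : ∀ a : EucSp N → ℝ, IsW1inf Ω a → ∀ u : H,
      ∃ v : H, Filter.EventuallyEq (MeasureTheory.ae (MeasureTheory.volume.restrict Ω))
        (toL2 v) (fun x => (a x : ℂ) * (toL2 u : EucSp N → ℂ) x)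

attribute [instance] DirichletSetting.normedAddCommGroup DirichletSetting.normedSpace

open MeasureTheory Filter Metric Set Complex ENNReal NNReal

variable {N : ℕ}

/-- The `L²(Ω)` measure. -/
def DirichletSetting.μ (S : DirichletSetting N) : Measure (EucSp N) :=
  volume.restrict S.Ω

/-- The real `H⁻¹–H¹₀` duality pairing `⟨Δu, φ⟩ = -Re ∫_Ω ∇u · ∇φ̄`. -/
def deltaPair (S : DirichletSetting N) (u φ : S.H) : ℝ :=
  -(inner ℂ (S.grad u) (S.grad φ) : ℂ).re

/-- The real `L²–L²` duality pairing `⟨v, w⟩ = Re ∫_Ω v w̄`. -/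
def l2Pair (S : DirichletSetting N) (v w : S.H) : ℝ :=
  (inner ℂ (S.toL2 w) (S.toL2 v) : ℂ).re

/-- `u` is a weak solution on `(0,∞)` of `i∂ₜu + Δu + f(u) = 0`, `u(0) = u₀`,
bounded in `H¹₀(Ω)`, with `f(u) ∈ L^∞((0,T);H⁻¹(Ω))` for every `T > 0`. -/
def IsWeakSolutionPos (S : DirichletSetting N) (f : S.H → (S.H →L[ℝ] ℝ))
    (u : ℝ → S.H) (u₀ : S.H) : Prop :=
  u 0 = u₀ ∧
  (∃ C : ℝ, ∀ t ∈ Set.Ioi (0 : ℝ), ‖u t‖ ≤ C) ∧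
  (∀ T : ℝ, 0 < T → ∃ C : ℝ, ∀ t ∈ Set.Ioo (0 : ℝ) T, ‖f (u t)‖ ≤ C) ∧
  (∀ (φ : S.H) (ψ : ℝ → ℝ), ContDiff ℝ (⊤ : ℕ∞) ψ → HasCompactSupport ψ →
    tsupport ψ ⊆ Set.Ioi (0 : ℝ) →
    ∫ t in Set.Ioi (0 : ℝ),
        (-(l2Pair S (Complex.I • u t) φ) * deriv ψ t
          + (deltaPair S (u t) φ + f (u t) φ) * ψ t) = 0)

/-- `‖∇u‖_{L^∞(I;L²(Ω))}` for a family `u : ℝ → H¹₀(Ω)`. -/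
def gradSup (S : DirichletSetting N) (u : ℝ → S.H) (I : Set ℝ) : ℝ :=
  sSup ((fun t => ‖S.grad (u t)‖) '' I)


/-- The two-sided conclusion of Bégout's Theorem 2.3: for every `r ∈ [2,∞]` and
every `c ∈ Ω`,
`liminf_{t→±∞} |t|^{N(1/2-1/r)} ‖u(t)‖_{L^r(Ω∩{|x-c|<M₀|t|})} ≥ ε |B(0,M₀)|^{-(1/2-1/r)}`. -/
def lowerBoundTwoSided (S : DirichletSetting N) (u : ℝ → S.H) (ε M₀ : ℝ) : Prop :=
  ∀ r : ℝ≥0∞, 2 ≤ r → ∀ c ∈ S.Ω,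
    (ENNReal.ofReal ε * (volume (Metric.ball (0 : EucSp N) M₀)) ^ (-((1:ℝ)/2 - (1/r).toReal))
      ≤ Filter.liminf (fun t : ℝ =>
          ENNReal.ofReal (|t| ^ ((N : ℝ) * ((1:ℝ)/2 - (1/r).toReal))) *
            eLpNorm (S.toL2 (u t)) r (volume.restrict (S.Ω ∩ Metric.ball c (M₀ * |t|))))
        Filter.atTop) ∧
    (ENNReal.ofReal ε * (volume (Metric.ball (0 : EucSp N) M₀)) ^ (-((1:ℝ)/2 - (1/r).toReal))
      ≤ Filter.liminf (fun t : ℝ =>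
          ENNReal.ofReal (|t| ^ ((N : ℝ) * ((1:ℝ)/2 - (1/r).toReal))) *
            eLpNorm (S.toL2 (u t)) r (volume.restrict (S.Ω ∩ Metric.ball c (M₀ * |t|))))
        Filter.atBot)
/-- The Hartree energy
`E(v) = (1/2)‖∇v‖²_{L²} + (1/4)∫ (W∗|v|²)(x) |v(x)|² dx`. -/
def hartreeEnergy (S : DirichletSetting N) (W : EucSp N → ℝ) (v : S.H) : ℝ :=
  (1 / 2) * ‖S.grad v‖ ^ 2 +
    (1 / 4) * ∫ x, (∫ y, W (x - y) * ‖(S.toL2 v) y‖ ^ 2 ∂S.μ) * ‖(S.toL2 v) x‖ ^ 2 ∂S.μ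


open Topology

lemma ibp_real {C : ℝ≥0} {χ g : EucSp N → ℝ} (hχ : LipschitzWith C χ)
    (hg : ContDiff ℝ 1 g) (hgc : HasCompactSupport g) (e : EucSp N) :
    ∫ x, χ x * fderiv ℝ g x e = -∫ x, lineDeriv ℝ χ x e * g x := by
  obtain ⟨D, hD⟩ := hg.lipschitzWith_of_hasCompactSupport hgc one_ne_zero
  rw [hχ.integral_lineDeriv_mul_eq hD hgc e, ← integral_neg]
  congr 1
  ext x
  rw [(hg.differentiable one_ne_zero x).lineDeriv_eq_fderiv]
  simp; ring

lemma memLp_lip {C : ℝ≥0} {χ : EucSp N → ℝ} (hχ : LipschitzWith C χ)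
    (hc : HasCompactSupport χ) (e : EucSp N) (p : ℝ≥0∞) :
    MemLp χ p volume ∧ MemLp (fun x => lineDeriv ℝ χ x e) p volume := by
  refine ⟨hχ.continuous.memLp_of_hasCompactSupport hc, ?_⟩
  have hs : HasCompactSupport (fun x => lineDeriv ℝ χ x e) := by
    apply HasCompactSupport.intro hc
    intro x hx
    have : χ =ᶠ[𝓝 x] fun _ => 0 := by
      have := (isClosed_tsupport χ).isOpen_compl.mem_nhds hx
      filter_upwards [this] with y hy
      exact image_eq_zero_of_notMem_tsupport hy
    have h2 := (hasFDerivAt_const (𝕜 := ℝ) (0:ℝ) x).congr_of_eventuallyEq this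
    rw [h2.differentiableAt.lineDeriv_eq_fderiv, h2.fderiv]; simp
  exact hs.memLp_of_bound (aestronglyMeasurable_lineDeriv hχ.continuous _)
    (C * ‖e‖) (.of_forall fun x => norm_lineDeriv_le_of_lipschitz ℝ hχ)

lemma ofReal_memLp {f : EucSp N → ℝ} {p : ℝ≥0∞} {μ : Measure (EucSp N)} (hf : MemLp f p μ) :
    MemLp (fun x => (f x : ℂ)) p μ := hf.ofReal

lemma ibp_complex {C : ℝ≥0} {χ : EucSp N → ℝ} (hχ : LipschitzWith C χ)
    (hc : HasCompactSupport χ) {φ : EucSp N → ℂ}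
    (hg : ContDiff ℝ 1 φ) (hgc : HasCompactSupport φ) (e : EucSp N) :
    ∫ x, (χ x : ℂ) * fderiv ℝ φ x e = -∫ x, ((lineDeriv ℝ χ x e : ℝ) : ℂ) * φ x := by
  have hd : Continuous (fun x => fderiv ℝ φ x e) :=
    (hg.continuous_fderiv one_ne_zero).clm_apply continuous_const
  have hdc : HasCompactSupport (fun x => fderiv ℝ φ x e) := hgc.fderiv_apply ℝ e
  have i1 : Integrable (fun x => (χ x : ℂ) * fderiv ℝ φ x e) :=
    MemLp.integrable_mul (p := 2) (q := 2) (ofReal_memLp (memLp_lip hχ hc e 2).1)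
      (hd.memLp_of_hasCompactSupport hdc)
  have i2 : Integrable (fun x => ((lineDeriv ℝ χ x e : ℝ) : ℂ) * φ x) :=
    MemLp.integrable_mul (p := 2) (q := 2) (ofReal_memLp (memLp_lip hχ hc e 2).2)
      (hg.continuous.memLp_of_hasCompactSupport hgc)
  apply Complex.ext
  · have h := ibp_real hχ (g := fun x => (φ x).re) (Complex.reCLM.contDiff.comp hg)
      (hgc.comp_left (g := Complex.re) rfl) e
    have h1 := Complex.reCLM.integral_comp_comm i1
    have h2 := Complex.reCLM.integral_comp_comm i2
    simp only [Complex.reCLM_apply, Complex.re_ofReal_mul] at h1 h2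
    rw [Complex.neg_re, ← h1, ← h2, ← h]
    congr 1; ext x
    have := (Complex.reCLM.hasFDerivAt (x := φ x)).comp x (hg.differentiable one_ne_zero x).hasFDerivAt
    have h3 : fderiv ℝ (fun x => (φ x).re) x = Complex.reCLM ∘L fderiv ℝ φ x := this.fderiv
    rw [h3]; rfl
  · have h := ibp_real hχ (g := fun x => (φ x).im) (Complex.imCLM.contDiff.comp hg)
      (hgc.comp_left (g := Complex.im) rfl) e
    have h1 := Complex.imCLM.integral_comp_comm i1
    have h2 := Complex.imCLM.integral_comp_comm i2
    simp only [Complex.imCLM_apply, Complex.im_ofReal_mul] at h1 h2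
    rw [Complex.neg_im, ← h1, ← h2, ← h]
    congr 1; ext x
    have := (Complex.imCLM.hasFDerivAt (x := φ x)).comp x (hg.differentiable one_ne_zero x).hasFDerivAt
    have h3 : fderiv ℝ (fun x => (φ x).im) x = Complex.imCLM ∘L fderiv ℝ φ x := this.fderiv
    rw [h3]; rfl

lemma norm_toL2_le (S : DirichletSetting N) (u : S.H) : ‖S.toL2 u‖ ≤ ‖u‖ := by
  have := S.norm_eq u
  exact abs_le_of_sq_le_sq' (by nlinarith [sq_nonneg ‖S.grad u‖]) (norm_nonneg _) |>.2

lemma norm_grad_le (S : DirichletSetting N) (u : S.H) : ‖S.grad u‖ ≤ ‖u‖ := by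
  have := S.norm_eq u
  exact abs_le_of_sq_le_sq' (by nlinarith [sq_nonneg ‖S.toL2 u‖]) (norm_nonneg _) |>.2

lemma memLp_single {f : EucSp N → ℝ} {μ : Measure (EucSp N)} (hf : MemLp f 2 μ) (j : Fin N) :
    MemLp (fun x => EuclideanSpace.single j (f x : ℂ)) 2 μ := by
  refine hf.of_le ?_ (.of_forall fun x => by simp)
  have : (fun x => EuclideanSpace.single j (f x : ℂ))
      = fun x => (f x) • (EuclideanSpace.single j (1 : ℂ)) := by
    ext x i; by_cases h : i = j <;> simp [h]
  rw [this]
  exact hf.1.smul aestronglyMeasurable_const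

lemma weak_grad (S : DirichletSetting N) (hμ : volume.restrict S.Ω = volume)
    {C : ℝ≥0} {χ : EucSp N → ℝ} (hχ : LipschitzWith C χ)
    (hc : HasCompactSupport χ) (j : Fin N) (u : S.H) :
    ∫ x, (χ x : ℂ) * (S.grad u x) j ∂(volume.restrict S.Ω)
      = -∫ x, ((lineDeriv ℝ χ x (EuclideanSpace.single j 1) : ℝ) : ℂ) * S.toL2 u x
          ∂(volume.restrict S.Ω) := by
  set e : EucSp N := EuclideanSpace.single j 1
  obtain ⟨m1, m2⟩ := memLp_lip hχ hc e 2
  have m1' : MemLp χ 2 (volume.restrict S.Ω) := m1.restrict _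
  have m2' : MemLp (fun x => lineDeriv ℝ χ x e) 2 (volume.restrict S.Ω) := m2.restrict _
  set X := (memLp_single m1' j).toLp
  set Y := (ofReal_memLp m2').toLp
  have hX : ∀ w : S.H, ∫ x, (χ x : ℂ) * (S.grad w x) j ∂(volume.restrict S.Ω)
      = inner ℂ X (S.grad w) := by
    intro w
    rw [L2.inner_def]
    apply integral_congr_ae
    filter_upwards [(memLp_single m1' j).coeFn_toLp] with x hx
    rw [hx, EuclideanSpace.inner_single_left]; simp
  have hY : ∀ w : S.H, ∫ x, ((lineDeriv ℝ χ x e : ℝ) : ℂ) * S.toL2 w x ∂(volume.restrict S.Ω)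
      = inner ℂ Y (S.toL2 w) := by
    intro w
    rw [L2.inner_def]
    apply integral_congr_ae
    filter_upwards [(ofReal_memLp m2').coeFn_toLp] with x hx
    rw [hx]; simp [mul_comm]
  rw [hX, hY, eq_neg_iff_add_eq_zero, ← norm_le_zero_iff]
  apply _root_.le_of_forall_pos_le_add
  intro δ hδ
  obtain ⟨v, φ, h1, h2, h3, -, h5, h6⟩ := S.dense_test u (δ / (‖X‖ + ‖Y‖ + 1)) (by positivity)
  have hz : inner ℂ X (S.grad v) + inner ℂ Y (S.toL2 v) = 0 := by
    rw [← hX, ← hY, ← eq_neg_iff_add_eq_zero]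
    have := ibp_complex hχ hc (h2.of_le (by exact_mod_cast le_top)) h3 e
    rw [← hμ] at this
    refine Eq.trans ?_ (this.trans (congrArg Neg.neg ?_))
    · apply integral_congr_ae
      filter_upwards [h6] with x hx
      rw [hx]; rfl
    · apply integral_congr_ae
      filter_upwards [h5] with x hx
      rw [hx]
  have : inner ℂ X (S.grad u) + inner ℂ Y (S.toL2 u)
      = inner ℂ X (S.grad (u - v)) + inner ℂ Y (S.toL2 (u - v)) := by
    rw [map_sub, map_sub, inner_sub_right, inner_sub_right]
    linear_combination hz
  rw [this, zero_add]
  calc _ ≤ ‖X‖ * ‖S.grad (u - v)‖ + ‖Y‖ * ‖S.toL2 (u - v)‖ :=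
        (norm_add_le _ _).trans (add_le_add (norm_inner_le_norm _ _) (norm_inner_le_norm _ _))
    _ ≤ ‖X‖ * ‖u - v‖ + ‖Y‖ * ‖u - v‖ := by
        gcongr
        · exact norm_grad_le S _
        · exact norm_toL2_le S _
    _ ≤ (‖X‖ + ‖Y‖ + 1) * ‖u - v‖ := by nlinarith [norm_nonneg (u - v)]
    _ ≤ (‖X‖ + ‖Y‖ + 1) * (δ / (‖X‖ + ‖Y‖ + 1)) := by gcongr
    _ = δ := by field_simp

lemma memLp_meas {F : Type*} [NormedAddCommGroup F] {μ ν : Measure (EucSp N)} (h : μ = ν)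
    {f : EucSp N → F} {p : ℝ≥0∞} (hf : MemLp f p μ) : MemLp f p ν := h ▸ hf

lemma ae_meas {μ ν : Measure (EucSp N)} (h : μ = ν)
    {p : EucSp N → Prop} (hf : ∀ᵐ x ∂μ, p x) : ∀ᵐ x ∂ν, p x := h ▸ hf

lemma int_meas {μ ν : Measure (EucSp N)} (h : μ = ν)
    (f : EucSp N → ℂ) : ∫ x, f x ∂ν = ∫ x, f x ∂μ := h ▸ rfl

lemma grad_comp_memLp (S : DirichletSetting N) (u : S.H) (j : Fin N) :
    MemLp (fun x => (S.grad u x) j) 2 (volume.restrict S.Ω) :=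
  (Lp.memLp (S.grad u)).of_le
    ((EuclideanSpace.proj (𝕜 := ℂ) j).continuous.comp_aestronglyMeasurable
      (Lp.aestronglyMeasurable _)) (.of_forall fun x => PiLp.norm_apply_le _ _)

lemma bdd_mul_memLp {μ : Measure (EucSp N)} {f : EucSp N → ℂ} {a : EucSp N → ℝ} {B : ℝ}
    (ha : AEStronglyMeasurable a μ) (hB : ∀ x, |a x| ≤ B) (hf : MemLp f 2 μ) :
    MemLp (fun x => (a x : ℂ) * f x) 2 μ := by
  refine hf.of_le_mul (c := B) ?_ (.of_forall fun x => ?_)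
  · exact (Complex.continuous_ofReal.comp_aestronglyMeasurable ha).mul hf.1
  · rw [norm_mul, Complex.norm_real]
    exact mul_le_mul_of_nonneg_right (hB x) (norm_nonneg _)

lemma lip_mul {C L : ℝ≥0} {ψ a : EucSp N → ℝ} (hψ : LipschitzWith C ψ) (ha : LipschitzWith L a)
    {A B : ℝ} (hA : ∀ x, |ψ x| ≤ A) (hB : ∀ x, |a x| ≤ B) :
    LipschitzWith (Real.toNNReal (A * L + B * C)) (fun x => ψ x * a x) := by
  have hA0 : 0 ≤ A := (abs_nonneg _).trans (hA 0)
  have hB0 : 0 ≤ B := (abs_nonneg _).trans (hB 0)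
  refine LipschitzWith.of_dist_le_mul fun x y => ?_
  rw [Real.coe_toNNReal _ (by positivity), Real.dist_eq]
  have h1 := hψ.dist_le_mul x y
  have h2 := ha.dist_le_mul x y
  rw [Real.dist_eq] at h1 h2
  calc |ψ x * a x - ψ y * a y| = |ψ x * (a x - a y) + a y * (ψ x - ψ y)| := by ring_nf
    _ ≤ |ψ x| * |a x - a y| + |a y| * |ψ x - ψ y| := by
        rw [← abs_mul, ← abs_mul]; exact abs_add_le _ _
    _ ≤ A * (L * dist x y) + B * (C * dist x y) := by
        gcongr
        · exact hA x
        · exact hB y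
    _ = _ := by ring

lemma grad_mul_comp (S : DirichletSetting N) (hμ : volume.restrict S.Ω = volume)
    {L : ℝ≥0} {a : EucSp N → ℝ} (ha : LipschitzWith L a) {B : ℝ} (hB : ∀ x, |a x| ≤ B)
    (u v : S.H) (hv : ∀ᵐ x ∂(volume.restrict S.Ω), S.toL2 v x = (a x : ℂ) * S.toL2 u x)
    (j : Fin N) :
    ∀ᵐ x ∂(volume.restrict S.Ω), (S.grad v x) j - (a x : ℂ) * (S.grad u x) j
      - ((lineDeriv ℝ a x (EuclideanSpace.single j 1) : ℝ) : ℂ) * S.toL2 u x = 0 := by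
  set e : EucSp N := EuclideanSpace.single j 1 with he
  have mv := grad_comp_memLp S v j
  have mu := bdd_mul_memLp (μ := volume.restrict S.Ω) ha.continuous.aestronglyMeasurable hB
    (grad_comp_memLp S u j)
  have mau := bdd_mul_memLp (μ := volume.restrict S.Ω)
    (a := fun x => lineDeriv ℝ a x e)
    (aestronglyMeasurable_lineDeriv ha.continuous _)
    (fun x => norm_lineDeriv_le_of_lipschitz ℝ ha) (Lp.memLp (S.toL2 u))
  have mu2 := bdd_mul_memLp (μ := volume.restrict S.Ω) ha.continuous.aestronglyMeasurable hB
    (Lp.memLp (S.toL2 u))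
  refine ae_meas hμ.symm (ae_eq_zero_of_integral_contDiff_smul_eq_zero ?_ ?_)
  · exact (memLp_meas hμ ((mv.sub mu).sub mau)).locallyIntegrable (by norm_num)
  intro ψ hψ hψc
  have hψ1 : ContDiff ℝ 1 ψ := hψ.of_le (by exact_mod_cast le_top)
  obtain ⟨C, hC⟩ := hψ1.lipschitzWith_of_hasCompactSupport hψc one_ne_zero
  obtain ⟨A, hA⟩ : ∃ A, ∀ x, |ψ x| ≤ A := hψc.exists_bound_of_continuous hC.continuous
  have hlip := lip_mul hC ha hA hB
  have w1 := weak_grad S hμ hC hψc j v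
  have w2 := weak_grad S hμ hlip hψc.mul_right j u
  rw [← he] at w1 w2
  obtain ⟨p1, p2⟩ := memLp_lip hC hψc e 2
  have p1 := ofReal_memLp (p1.restrict S.Ω)
  have p2 := ofReal_memLp (p2.restrict S.Ω)
  have i1 := MemLp.integrable_mul p1 mv
  have i2 := MemLp.integrable_mul p1 mu
  have i3 := MemLp.integrable_mul p1 mau
  have i4 := MemLp.integrable_mul p2 mu2
  simp only [Pi.mul_def] at i1 i2 i3 i4
  have w1' : ∫ x, ((lineDeriv ℝ ψ x e : ℝ) : ℂ) * S.toL2 v x ∂(volume.restrict S.Ω)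
      = ∫ x, ((lineDeriv ℝ ψ x e : ℝ) : ℂ) * ((a x : ℂ) * S.toL2 u x) ∂(volume.restrict S.Ω) := by
    apply integral_congr_ae
    filter_upwards [hv] with x hx
    rw [hx]
  have w2' : ∫ x, ((lineDeriv ℝ (fun x => ψ x * a x) x e : ℝ) : ℂ) * S.toL2 u x
        ∂(volume.restrict S.Ω)
      = ∫ x, (((lineDeriv ℝ ψ x e : ℝ) : ℂ) * ((a x : ℂ) * S.toL2 u x)
        + (ψ x : ℂ) * (((lineDeriv ℝ a x e : ℝ) : ℂ) * S.toL2 u x)) ∂(volume.restrict S.Ω) := by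
    apply integral_congr_ae
    filter_upwards [ae_meas hμ.symm ha.ae_differentiableAt] with x hx
    have d1 := hψ1.differentiable one_ne_zero x
    have d2 := d1.hasFDerivAt.mul hx.hasFDerivAt
    have : lineDeriv ℝ (fun x => ψ x * a x) x e = ψ x * fderiv ℝ a x e + a x * fderiv ℝ ψ x e := by
      have d3 : fderiv ℝ (fun x => ψ x * a x) x = _ := d2.fderiv
      have d4 : DifferentiableAt ℝ (fun x => ψ x * a x) x := d2.differentiableAt
      rw [d4.lineDeriv_eq_fderiv, d3]
      simp
    rw [this, d1.lineDeriv_eq_fderiv, hx.lineDeriv_eq_fderiv]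
    push_cast; ring
  rw [integral_add i4 i3] at w2'
  refine (int_meas hμ _).trans ?_
  have e1 : ∀ x, ψ x • ((S.grad v x) j - (a x : ℂ) * (S.grad u x) j
      - ((lineDeriv ℝ a x e : ℝ) : ℂ) * S.toL2 u x)
      = (ψ x : ℂ) * (S.grad v x) j - (ψ x : ℂ) * ((a x : ℂ) * (S.grad u x) j)
        - (ψ x : ℂ) * (((lineDeriv ℝ a x e : ℝ) : ℂ) * S.toL2 u x) := by
    intro x; rw [Complex.real_smul]; ring
  simp_rw [e1]
  have i12 : Integrable (fun x => (ψ x : ℂ) * (S.grad v x) j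
      - (ψ x : ℂ) * ((a x : ℂ) * (S.grad u x) j)) (volume.restrict S.Ω) := i1.sub i2
  rw [integral_sub i12 i3, integral_sub i1 i2, w1, w1']
  rw [w2'] at w2
  push_cast at w2
  simp only [mul_assoc] at w2
  linear_combination -w2

lemma grad_mul_le (S : DirichletSetting N) (hμ : volume.restrict S.Ω = volume)
    {L : ℝ≥0} {a : EucSp N → ℝ} (ha : LipschitzWith L a) {B : ℝ} (hB : ∀ x, |a x| ≤ B)
    (u v : S.H) (hv : ∀ᵐ x ∂(volume.restrict S.Ω), S.toL2 v x = (a x : ℂ) * S.toL2 u x) :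
    ∀ᵐ x ∂(volume.restrict S.Ω),
      ‖S.grad v x - (a x : ℂ) • S.grad u x‖ ≤ L * ‖S.toL2 u x‖ := by
  have h1 := ae_all_iff.2 (fun j => grad_mul_comp S hμ ha hB u v hv j)
  filter_upwards [h1, ae_meas hμ.symm ha.ae_differentiableAt] with x hx hd
  set z := (InnerProductSpace.toDual ℝ (EucSp N)).symm (fderiv ℝ a x) with hz
  have hzn : ‖z‖ ≤ L := by
    rw [hz, LinearIsometryEquiv.norm_map]; exact norm_fderiv_le_of_lipschitz ℝ ha
  have hzj : ∀ j, z j = fderiv ℝ a x (EuclideanSpace.single j 1) := by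
    intro j
    have := InnerProductSpace.toDual_symm_apply (𝕜 := ℝ) (x := EuclideanSpace.single j (1:ℝ)) (y := fderiv ℝ a x)
    rw [← this, ← hz, EuclideanSpace.inner_single_right]; simp
  have hw : ‖S.grad v x - (a x : ℂ) • S.grad u x‖ ^ 2 = (‖z‖ * ‖S.toL2 u x‖) ^ 2 := by
    rw [mul_pow, EuclideanSpace.norm_sq_eq, EuclideanSpace.norm_sq_eq, Finset.sum_mul]
    refine Finset.sum_congr rfl fun j _ => ?_
    have := hx j
    rw [hd.lineDeriv_eq_fderiv, ← hzj] at this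
    rw [sub_eq_zero] at this
    rw [PiLp.sub_apply, PiLp.smul_apply, smul_eq_mul, this, norm_mul, Complex.norm_real, mul_pow]
  have := (sq_eq_sq₀ (norm_nonneg _) (by positivity)).1 hw
  rw [this]; gcongr

structure CutOp (S : DirichletSetting N) (a : EucSp N → ℝ) (L : ℝ) where
  A : S.H → S.H
  toL2_A : ∀ u, ∀ᵐ x ∂(volume.restrict S.Ω), S.toL2 (A u) x = (a x : ℂ) * S.toL2 u x
  A_sub : ∀ u v, A (u - v) = A u - A v
  A_bdd : ∃ K : ℝ, 0 ≤ K ∧ ∀ u, ‖A u‖ ≤ K * ‖u‖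
  A_im : ∀ u, |(inner ℂ (S.grad u) (S.grad (A u)) : ℂ).im| ≤ L * ‖S.grad u‖ * ‖S.toL2 u‖

lemma exists_cutOp (S : DirichletSetting N) (hμ : volume.restrict S.Ω = volume)
    {L : ℝ≥0} {a : EucSp N → ℝ} (ha : LipschitzWith L a) {B : ℝ} (hB : ∀ x, |a x| ≤ B) :
    Nonempty (CutOp S a L) := by
  have hB0 : 0 ≤ B := (abs_nonneg _).trans (hB 0)
  choose A hA using S.smul_W1inf_mem a ⟨⟨L, ha.lipschitzOnWith⟩, B, fun x _ => hB x⟩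
  have hA' : ∀ u, ∀ᵐ x ∂(volume.restrict S.Ω), S.toL2 (A u) x = (a x : ℂ) * S.toL2 u x := hA
  have key : ∀ u, ∃ M : Lp (EuclideanSpace ℂ (Fin N)) 2 (volume.restrict S.Ω),
      ‖S.grad (A u) - M‖ ≤ L * ‖S.toL2 u‖ ∧ ‖M‖ ≤ B * ‖S.grad u‖ ∧
      (inner ℂ (S.grad u) M : ℂ).im = 0 := by
    intro u
    have hm : MemLp (fun x => (a x : ℂ) • S.grad u x) 2 (volume.restrict S.Ω) := by
      refine (Lp.memLp (S.grad u)).of_le_mul (c := B) ?_ (.of_forall fun x => ?_)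
      · exact (Complex.continuous_ofReal.comp_aestronglyMeasurable
          ha.continuous.aestronglyMeasurable).smul (Lp.aestronglyMeasurable _)
      · rw [norm_smul, Complex.norm_real]
        exact mul_le_mul_of_nonneg_right (hB x) (norm_nonneg _)
    set M1 := hm.toLp
    refine ⟨M1, ?_, ?_, ?_⟩
    · apply Lp.norm_le_mul_norm_of_ae_le_mul
      filter_upwards [grad_mul_le S hμ ha hB u (A u) (hA' u), hm.coeFn_toLp,
        Lp.coeFn_sub (S.grad (A u)) hm.toLp] with x h1 h2 h3
      rw [h3, Pi.sub_apply, h2]; exact h1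
    · apply Lp.norm_le_mul_norm_of_ae_le_mul
      filter_upwards [hm.coeFn_toLp] with x h2
      rw [h2, norm_smul, Complex.norm_real]
      exact mul_le_mul_of_nonneg_right (hB x) (norm_nonneg _)
    · rw [L2.inner_def]
      have : ∫ x, inner ℂ (S.grad u x) (M1 x) ∂(volume.restrict S.Ω)
          = ∫ x, ((a x * ‖S.grad u x‖ ^ 2 : ℝ) : ℂ) ∂(volume.restrict S.Ω) := by
        apply integral_congr_ae
        filter_upwards [hm.coeFn_toLp] with x h2
        rw [h2, inner_smul_right, inner_self_eq_norm_sq_to_K]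
        push_cast; rfl
      rw [this, integral_complex_ofReal]
      exact Complex.ofReal_im _
  refine ⟨⟨A, hA', ?_, ⟨2 * B + L, by positivity, ?_⟩, ?_⟩⟩
  · intro u v
    apply S.toL2_injective
    rw [map_sub]
    apply Lp.ext
    have h4 := Lp.coeFn_sub (S.toL2 u) (S.toL2 v)
    rw [← map_sub] at h4
    filter_upwards [hA' u, hA' v, hA' (u - v), h4,
      Lp.coeFn_sub (S.toL2 (A u)) (S.toL2 (A v))] with x h1 h2 h3 h4 h5
    rw [h5, Pi.sub_apply, h3, h4, h1, h2, Pi.sub_apply]; ring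
  · intro u
    obtain ⟨M, h1, h2, -⟩ := key u
    have h3 : ‖S.toL2 (A u)‖ ≤ B * ‖S.toL2 u‖ := by
      apply Lp.norm_le_mul_norm_of_ae_le_mul
      filter_upwards [hA' u] with x hx
      rw [hx, norm_mul, Complex.norm_real]
      exact mul_le_mul_of_nonneg_right (hB x) (norm_nonneg _)
    have h4 : ‖S.grad (A u)‖ ≤ L * ‖S.toL2 u‖ + B * ‖S.grad u‖ := by
      calc ‖S.grad (A u)‖ = ‖(S.grad (A u) - M) + M‖ := by rw [sub_add_cancel]
        _ ≤ _ := (norm_add_le _ _).trans (add_le_add h1 h2)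
    have h5 := norm_toL2_le S u
    have h6 := norm_grad_le S u
    have h7 : ‖S.toL2 (A u)‖ ≤ B * ‖u‖ := h3.trans (by gcongr)
    have h8 : ‖S.grad (A u)‖ ≤ (B + L) * ‖u‖ := by
      refine h4.trans ?_
      calc _ ≤ L * ‖u‖ + B * ‖u‖ := by gcongr
        _ = _ := by ring
    refine abs_le_of_sq_le_sq' ?_ (by positivity) |>.2
    rw [S.norm_eq]
    calc _ ≤ (B * ‖u‖) ^ 2 + ((B + L) * ‖u‖) ^ 2 := by gcongr
      _ ≤ (B * ‖u‖ + (B + L) * ‖u‖) ^ 2 := by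
          have : 0 ≤ (B * ‖u‖) * ((B + L) * ‖u‖) := by positivity
          nlinarith
      _ = _ := by ring
  · intro u
    obtain ⟨M, h1, h2, h3⟩ := key u
    have : (inner ℂ (S.grad u) (S.grad (A u)) : ℂ).im
        = (inner ℂ (S.grad u) (S.grad (A u) - M) : ℂ).im := by
      rw [inner_sub_right, Complex.sub_im, h3, sub_zero]
    rw [this]
    calc _ ≤ ‖(inner ℂ (S.grad u) (S.grad (A u) - M) : ℂ)‖ := Complex.abs_im_le_norm _
      _ ≤ ‖S.grad u‖ * ‖S.grad (A u) - M‖ := norm_inner_le_norm _ _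
      _ ≤ ‖S.grad u‖ * (L * ‖S.toL2 u‖) := by gcongr
      _ = _ := by ring

lemma l2Pair_sub_left (S : DirichletSetting N) (a b c : S.H) :
    l2Pair S (a - b) c = l2Pair S a c - l2Pair S b c := by
  simp [l2Pair, inner_sub_right]

lemma l2Pair_sub_right (S : DirichletSetting N) (a b c : S.H) :
    l2Pair S a (b - c) = l2Pair S a b - l2Pair S a c := by
  simp [l2Pair, inner_sub_left]

lemma l2Pair_cut (S : DirichletSetting N) {a : EucSp N → ℝ} {L : ℝ} (T : CutOp S a L) (u v : S.H) :
    l2Pair S u (T.A v) = l2Pair S v (T.A u) := by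
  unfold l2Pair
  rw [← inner_conj_symm (S.toL2 (T.A u)), Complex.conj_re, L2.inner_def, L2.inner_def]
  congr 1
  apply integral_congr_ae
  filter_upwards [T.toL2_A u, T.toL2_A v] with x h1 h2
  rw [h1, h2]
  simp; ring

lemma l2Pair_cut_self (S : DirichletSetting N) {a : EucSp N → ℝ} {L : ℝ} (T : CutOp S a L)
    (u : S.H) :
    l2Pair S u (T.A u) = ∫ x, a x * ‖S.toL2 u x‖ ^ 2 ∂(volume.restrict S.Ω) := by
  unfold l2Pair
  rw [L2.inner_def]
  have : ∫ x, inner ℂ (S.toL2 (T.A u) x) (S.toL2 u x) ∂(volume.restrict S.Ω)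
      = ∫ x, ((a x * ‖S.toL2 u x‖ ^ 2 : ℝ) : ℂ) ∂(volume.restrict S.Ω) := by
    apply integral_congr_ae
    filter_upwards [T.toL2_A u] with x h1
    rw [h1]
    have := Complex.mul_conj' (S.toL2 u x)
    simp
    linear_combination (a x : ℂ) * this
  rw [this, integral_complex_ofReal]
  exact Complex.ofReal_re _

lemma hasDerivAt_m (S : DirichletSetting N) {a : EucSp N → ℝ} {L : ℝ} (T : CutOp S a L)
    (u : ℝ → S.H) (hu_cont : Continuous u)
    (u' : ℝ → (S.H →L[ℝ] ℝ))
    (hu'_bdd : ∃ C : ℝ, ∀ t : ℝ, ‖u' t‖ ≤ C)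
    (hu'_deriv : ∀ (φ : S.H) (t : ℝ), HasDerivAt (fun s => l2Pair S (u s) φ) (u' t φ) t) (t : ℝ) :
    HasDerivAt (fun s => l2Pair S (u s) (T.A (u s))) (2 * u' t (T.A (u t))) t := by
  obtain ⟨C, hC⟩ := hu'_bdd
  have hC0 : 0 ≤ C := (norm_nonneg _).trans (hC 0)
  obtain ⟨K, hK0, hK⟩ := T.A_bdd
  have hq : HasDerivAt (fun s => l2Pair S (u s - u t) (T.A (u s - u t))) 0 t := by
    rw [hasDerivAt_iff_isLittleO, Asymptotics.isLittleO_iff]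
    intro c hc
    have ht : Tendsto (fun s => C * (K * ‖u s - u t‖)) (𝓝 t) (𝓝 0) := by
      have : Continuous (fun s => C * (K * ‖u s - u t‖)) := by fun_prop
      simpa using this.tendsto t
    filter_upwards [ht.eventually (gt_mem_nhds hc)] with s hs
    have hz : l2Pair S (u t - u t) (T.A (u t - u t)) = 0 := by
      rw [l2Pair_sub_left, sub_self]
    rw [hz, smul_zero, sub_zero, sub_zero]
    set φ := T.A (u s - u t)
    have hφ : ‖φ‖ ≤ K * ‖u s - u t‖ := hK _
    have := Convex.norm_image_sub_le_of_norm_hasDerivWithin_le (C := C * ‖φ‖)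
      (fun x _ => (hu'_deriv φ x).hasDerivWithinAt (s := Set.univ))
      (fun x _ => (u' x).le_of_opNorm_le (hC x) φ) convex_univ (Set.mem_univ t) (Set.mem_univ s)
    rw [l2Pair_sub_left]
    refine this.trans ?_
    gcongr
    exact le_trans (by gcongr) hs.le
  have h := (((hu'_deriv (T.A (u t)) t).const_mul 2).sub_const (l2Pair S (u t) (T.A (u t)))).add hq
  rw [add_zero] at h
  refine h.congr_of_eventuallyEq (.of_forall fun s => ?_)
  have := l2Pair_cut S T (u t) (u s)
  simp only [Pi.add_apply]
  rw [T.A_sub, l2Pair_sub_left, l2Pair_sub_right, l2Pair_sub_right, this]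
  ring

lemma u'_cut (S : DirichletSetting N) {a : EucSp N → ℝ} {L : ℝ} (T : CutOp S a L)
    (V : EucSp N → ℝ) (w : S.H) (d : S.H →L[ℝ] ℝ)
    (heq : ∀ φ : S.H,
      d ((-Complex.I) • φ) + deltaPair S w φ
        - (∫ x, ((V x : ℝ) : ℂ)
            * ((S.toL2 w) x * (starRingEnd ℂ) ((S.toL2 φ) x)) ∂S.μ).re
      = 0) : |d (T.A w)| ≤ L * ‖S.grad w‖ * ‖S.toL2 w‖ := by
  have h := heq (Complex.I • T.A w)
  rw [smul_smul] at h
  have hI : -Complex.I * Complex.I = 1 := by simp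
  rw [hI, one_smul] at h
  have h3 : (∫ x, ((V x : ℝ) : ℂ)
      * ((S.toL2 w) x * (starRingEnd ℂ) ((S.toL2 (Complex.I • T.A w)) x)) ∂S.μ).re = 0 := by
    have : ∫ x, ((V x : ℝ) : ℂ)
      * ((S.toL2 w) x * (starRingEnd ℂ) ((S.toL2 (Complex.I • T.A w)) x)) ∂S.μ
      = ∫ x, ((V x * a x * ‖S.toL2 w x‖ ^ 2 : ℝ) : ℂ) * (-Complex.I) ∂(volume.restrict S.Ω) := by
      apply integral_congr_ae
      have hs := Lp.coeFn_smul Complex.I (S.toL2 (T.A w))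
      rw [← map_smul] at hs
      change _ =ᵐ[volume.restrict S.Ω] _
      filter_upwards [T.toL2_A w, hs] with x h1 h2
      rw [h2, Pi.smul_apply, h1]
      have := Complex.mul_conj' (S.toL2 w x)
      simp
      linear_combination (Complex.I * (V x : ℂ) * (a x : ℂ)) * this
    rw [this, integral_mul_const, integral_complex_ofReal]
    simp
  rw [h3] at h
  have h4 : deltaPair S w (Complex.I • T.A w) = (inner ℂ (S.grad w) (S.grad (T.A w)) : ℂ).im := by
    unfold deltaPair
    rw [map_smul, inner_smul_right]; simp
  rw [h4] at h
  have : d (T.A w) = -(inner ℂ (S.grad w) (S.grad (T.A w)) : ℂ).im := by linarith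
  rw [this, abs_neg]
  exact T.A_im w

lemma lp_norm_sq {F : Type*} [NormedAddCommGroup F] [InnerProductSpace ℂ F]
    {μ : Measure (EucSp N)} (f : Lp F 2 μ) : ‖f‖ ^ 2 = ∫ x, ‖f x‖ ^ 2 ∂μ := by
  have h : (inner ℂ f f : ℂ) = ∫ x, ((‖f x‖ ^ 2 : ℝ) : ℂ) ∂μ := by
    rw [L2.inner_def]
    congr 1; ext x
    rw [inner_self_eq_norm_sq_to_K]; push_cast; rfl
  rw [integral_complex_ofReal, inner_self_eq_norm_sq_to_K] at h
  have h' : ((‖f‖ ^ 2 : ℝ) : ℂ) = ((∫ x, ‖f x‖ ^ 2 ∂μ : ℝ) : ℂ) := by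
    rw [← h]; push_cast; rfl
  exact_mod_cast h'

lemma lp_int_sq {F : Type*} [NormedAddCommGroup F]
    {μ : Measure (EucSp N)} (f : Lp F 2 μ) : Integrable (fun x => ‖f x‖ ^ 2) μ :=
  (memLp_two_iff_integrable_sq_norm (Lp.aestronglyMeasurable f)).1 (Lp.memLp f)

lemma arctan_lip : LipschitzWith 1 Real.arctan := by
  refine lipschitzWith_of_nnnorm_deriv_le Real.differentiable_arctan fun x => ?_
  rw [← NNReal.coe_le_coe, coe_nnnorm, Real.deriv_arctan, Real.norm_eq_abs, abs_of_pos (by positivity)]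
  rw [NNReal.coe_one, div_le_one (by positivity)]
  nlinarith [sq_nonneg x]

lemma hardy_test (j : Fin N) {φ : EucSp N → ℂ} (hφ : ContDiff ℝ 1 φ) (hc : HasCompactSupport φ) :
    ∫ x : EucSp N, (1 / (1 + x j ^ 2)) * ‖φ x‖ ^ 2 ≤
      ∫ x : EucSp N, Real.pi * (‖φ x‖ * ‖fderiv ℝ φ x (EuclideanSpace.single j 1)‖) := by
  set e : EucSp N := EuclideanSpace.single j 1 with he
  have hpr : LipschitzWith 1 (fun x : EucSp N => x j) := by
    refine LipschitzWith.of_dist_le_mul fun x y => ?_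
    rw [NNReal.coe_one, one_mul, dist_eq_norm, dist_eq_norm]
    exact PiLp.norm_apply_le (x - y) j
  have hb : LipschitzWith (1 * 1) (fun x : EucSp N => Real.arctan (x j)) := arctan_lip.comp hpr
  have hg : ContDiff ℝ 1 (fun x => ‖φ x‖ ^ 2) := hφ.norm_sq ℝ
  have hgc : HasCompactSupport (fun x => ‖φ x‖ ^ 2) := hc.comp_left (g := fun z => ‖z‖ ^ 2) (by simp)
  have h := ibp_real hb hg hgc e
  have hl : ∀ x : EucSp N, lineDeriv ℝ (fun x : EucSp N => Real.arctan (x j)) x e = 1 / (1 + x j ^ 2) := by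
    intro x
    have h1 : HasFDerivAt (fun x : EucSp N => x j) (EuclideanSpace.proj j : EucSp N →L[ℝ] ℝ) x :=
      (EuclideanSpace.proj j : EucSp N →L[ℝ] ℝ).hasFDerivAt
    have h2 := h1.arctan
    rw [h2.differentiableAt.lineDeriv_eq_fderiv, h2.fderiv]
    simp [he]
  simp_rw [hl] at h
  have : ∫ x : EucSp N, (1 / (1 + x j ^ 2)) * ‖φ x‖ ^ 2
      = ∫ x : EucSp N, -(Real.arctan (x j) * fderiv ℝ (fun x => ‖φ x‖ ^ 2) x e) := by
    rw [integral_neg, h, neg_neg]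
  rw [this]
  have hd : Continuous (fun x => fderiv ℝ φ x e) :=
    (hφ.continuous_fderiv one_ne_zero).clm_apply continuous_const
  have hdc : HasCompactSupport (fun x => fderiv ℝ φ x e) := hc.fderiv_apply ℝ e
  have hd2 : Continuous (fun x => fderiv ℝ (fun x => ‖φ x‖ ^ 2) x e) :=
    (hg.continuous_fderiv one_ne_zero).clm_apply continuous_const
  have hdc2 : HasCompactSupport (fun x => fderiv ℝ (fun x => ‖φ x‖ ^ 2) x e) := hgc.fderiv_apply ℝ e
  refine integral_mono ?_ ?_ fun x => ?_
  · exact ((hb.continuous.mul hd2).integrable_of_hasCompactSupport hdc2.mul_left).neg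
  · exact ((hφ.continuous.norm.mul hd.norm).integrable_of_hasCompactSupport
      (hc.norm.mul_right)).const_mul _
  · have h1 := ((hφ.differentiable one_ne_zero x).hasFDerivAt.norm_sq).fderiv
    have h2 : fderiv ℝ (fun x => ‖φ x‖ ^ 2) x e = 2 * inner ℝ (φ x) (fderiv ℝ φ x e) := by
      rw [h1]; simp; ring
    have h3 := abs_real_inner_le_norm (φ x) (fderiv ℝ φ x e)
    have h4 : |Real.arctan (x j)| ≤ Real.pi / 2 :=
      abs_le.2 ⟨(Real.neg_pi_div_two_lt_arctan _).le, (Real.arctan_lt_pi_div_two _).le⟩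
    simp only [h2]
    calc _ ≤ |Real.arctan (x j) * (2 * inner ℝ (φ x) (fderiv ℝ φ x e))| := neg_le_abs _
      _ = |Real.arctan (x j)| * (2 * |inner ℝ (φ x) (fderiv ℝ φ x e)|) := by
          rw [abs_mul, abs_mul, abs_two]
      _ ≤ Real.pi / 2 * (2 * (‖φ x‖ * ‖fderiv ℝ φ x e‖)) := by gcongr
      _ = _ := by ring

lemma grad_ne_zero (hN : 1 ≤ N) (S : DirichletSetting N) (hμ : volume.restrict S.Ω = volume)
    (u : S.H) (hu : S.grad u = 0) : u = 0 := by
  let j : Fin N := ⟨0, hN⟩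
  set μ := volume.restrict S.Ω with hμd
  let b : EucSp N → ℝ := fun x => 1 / (1 + x j ^ 2)
  have hb0 : ∀ x, 0 < b x := fun x => by positivity
  have hb1 : ∀ x, b x ≤ 1 := fun x => by
    show 1 / (1 + x j ^ 2) ≤ 1
    rw [div_le_one (by positivity)]
    nlinarith [sq_nonneg (x j)]
  have hbc : Continuous b := by
    have : Continuous fun x : EucSp N => x j := (EuclideanSpace.proj j : EucSp N →L[ℝ] ℝ).continuous
    exact continuous_const.div (by fun_prop) (fun x => by positivity)
  have hint : ∀ f : Lp ℂ 2 μ, Integrable (fun x => b x * ‖f x‖ ^ 2) μ := fun f => by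
    refine (lp_int_sq f).mono (hbc.aestronglyMeasurable.mul (lp_int_sq f).1) (.of_forall fun x => ?_)
    rw [norm_mul, Real.norm_eq_abs, abs_of_pos (hb0 x)]
    exact mul_le_of_le_one_left (norm_nonneg _) (hb1 x)
  have hle : ∀ f : Lp ℂ 2 μ, ∫ x, b x * ‖f x‖ ^ 2 ∂μ ≤ ‖f‖ ^ 2 := fun f => by
    rw [lp_norm_sq]
    exact integral_mono (hint f) (lp_int_sq f) fun x =>
      mul_le_of_le_one_left (by positivity) (hb1 x)
  set I := ∫ x, b x * ‖S.toL2 u x‖ ^ 2 ∂μ with hI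
  have key : ∀ δ : ℝ, 0 < δ → δ < 1 →
      I ≤ δ * (2 + Real.pi * ((‖u‖ + 1) ^ 2 + 1)) := by
    intro δ hδ hδ1
    obtain ⟨v, φ, h1, h2, h3, -, h5, h6⟩ := S.dense_test u δ hδ
    have hv : ‖v‖ ≤ ‖u‖ + 1 := by
      have := norm_sub_norm_le v u
      rw [norm_sub_rev] at this
      linarith
    have hgv : ‖S.grad v‖ ≤ δ := by
      have := norm_grad_le S (u - v)
      rw [map_sub, hu, zero_sub, norm_neg] at this
      linarith
    have hH := hardy_test j (h2.of_le (by exact_mod_cast le_top) : ContDiff ℝ 1 φ) h3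
    rw [← hμ] at hH
    have e1 : ∫ x, b x * ‖S.toL2 v x‖ ^ 2 ∂μ ≤ Real.pi / 2 * (δ * ((‖u‖ + 1) ^ 2 + 1)) := by
      calc ∫ x, b x * ‖S.toL2 v x‖ ^ 2 ∂μ = ∫ x, (1 / (1 + x j ^ 2)) * ‖φ x‖ ^ 2 ∂μ := by
            apply integral_congr_ae
            filter_upwards [h5] with x hx
            rw [hx]
        _ ≤ _ := hH
        _ ≤ ∫ x, Real.pi / 2 * (δ * ‖S.toL2 v x‖ ^ 2 + δ⁻¹ * ‖S.grad v x‖ ^ 2) ∂μ := by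
            refine integral_mono_of_nonneg (.of_forall fun x => by positivity) ?_ ?_
            · exact (((lp_int_sq _).const_mul _).add ((lp_int_sq _).const_mul _)).const_mul _
            · filter_upwards [h5, h6] with x hx5 hx6
              have hn : ‖fderiv ℝ φ x (EuclideanSpace.single j 1)‖ ≤ ‖S.grad v x‖ := by
                have := PiLp.norm_apply_le (S.grad v x) j
                rw [hx6] at this ⊢
                exact this
              rw [← hx5]
              have hp := Real.pi_pos
              have : ‖S.toL2 v x‖ * ‖fderiv ℝ φ x (EuclideanSpace.single j 1)‖
                ≤ (δ * ‖S.toL2 v x‖ ^ 2 + δ⁻¹ * ‖S.grad v x‖ ^ 2) / 2 := by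
                calc _ ≤ ‖S.toL2 v x‖ * ‖S.grad v x‖ := by gcongr
                  _ ≤ _ := by
                    have h7 := sq_nonneg (δ * ‖S.toL2 v x‖ - ‖S.grad v x‖)
                    have h8 : δ * ‖S.toL2 v x‖ ^ 2 + δ⁻¹ * ‖S.grad v x‖ ^ 2
                        - 2 * (‖S.toL2 v x‖ * ‖S.grad v x‖)
                        = δ⁻¹ * (δ * ‖S.toL2 v x‖ - ‖S.grad v x‖) ^ 2 := by
                      field_simp; ring
                    have h9 : 0 ≤ δ⁻¹ * (δ * ‖S.toL2 v x‖ - ‖S.grad v x‖) ^ 2 := by positivity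
                    linarith
              calc _ ≤ Real.pi * ((δ * ‖S.toL2 v x‖ ^ 2 + δ⁻¹ * ‖S.grad v x‖ ^ 2) / 2) := by gcongr
                _ = _ := by ring
        _ = Real.pi / 2 * (δ * ‖S.toL2 v‖ ^ 2 + δ⁻¹ * ‖S.grad v‖ ^ 2) := by
            rw [integral_const_mul, integral_add ((lp_int_sq _).const_mul _)
              ((lp_int_sq _).const_mul _), integral_const_mul, integral_const_mul,
              ← lp_norm_sq, ← lp_norm_sq]
        _ ≤ Real.pi / 2 * (δ * (‖u‖ + 1) ^ 2 + δ⁻¹ * δ ^ 2) := by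
            have := (norm_toL2_le S v).trans hv
            have hp := Real.pi_pos
            gcongr
        _ = _ := by field_simp
    have e2 : ∫ x, b x * ‖S.toL2 (u - v) x‖ ^ 2 ∂μ ≤ δ := by
      refine (hle _).trans ?_
      have := (norm_toL2_le S (u - v)).trans h1.le
      nlinarith [norm_nonneg (S.toL2 (u - v))]
    have e3 : I ≤ 2 * (∫ x, b x * ‖S.toL2 (u - v) x‖ ^ 2 ∂μ)
        + 2 * ∫ x, b x * ‖S.toL2 v x‖ ^ 2 ∂μ := by
      rw [← integral_const_mul, ← integral_const_mul, ← integral_add ((hint _).const_mul _)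
        ((hint _).const_mul _)]
      refine integral_mono_ae (hint _) (((hint _).const_mul _).add ((hint _).const_mul _)) ?_
      have h4 := Lp.coeFn_sub (S.toL2 u) (S.toL2 v)
      rw [← map_sub] at h4
      filter_upwards [h4] with x hx
      simp only [hx, Pi.sub_apply]
      have h7 : ‖S.toL2 u x‖ ≤ ‖S.toL2 u x - S.toL2 v x‖ + ‖S.toL2 v x‖ := by
        simpa using norm_add_le (S.toL2 u x - S.toL2 v x) (S.toL2 v x)
      have h8 : ‖S.toL2 u x‖ ^ 2 ≤ 2 * ‖S.toL2 u x - S.toL2 v x‖ ^ 2 + 2 * ‖S.toL2 v x‖ ^ 2 := by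
        nlinarith [norm_nonneg (S.toL2 u x), sq_nonneg (‖S.toL2 u x - S.toL2 v x‖ - ‖S.toL2 v x‖)]
      nlinarith [hb0 x]
    linarith
  have hI0 : I ≤ 0 := by
    by_contra! hpos
    set C := 2 + Real.pi * ((‖u‖ + 1) ^ 2 + 1)
    have hC : 0 < C := by have := Real.pi_pos; positivity
    have h1 := key (min (1/2) (I / (2 * C))) (by positivity)
      (lt_of_le_of_lt (min_le_left _ _) (by norm_num))
    have h2 : min (1/2) (I / (2 * C)) * C ≤ I / (2 * C) * C := by
      gcongr; exact min_le_right _ _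
    have h3 : I / (2 * C) * C = I / 2 := by field_simp
    linarith
  have hI1 : I = 0 := le_antisymm hI0 (integral_nonneg fun x => by have := hb0 x; positivity)
  rw [hI, integral_eq_zero_iff_of_nonneg (fun x => by have := hb0 x; positivity) (hint _)] at hI1
  apply S.toL2_injective
  rw [map_zero]
  apply (Lp.eq_zero_iff_ae_eq_zero).2
  filter_upwards [hI1] with x hx
  have := hb0 x
  simpa [this.ne'] using hx

lemma m_bound (S : DirichletSetting N) {a : EucSp N → ℝ} {L : ℝ} (hL : 0 ≤ L) (T : CutOp S a L)
    (W : EucSp N → ℝ)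
    (u : ℝ → S.H) (hu_cont : Continuous u)
    (u' : ℝ → (S.H →L[ℝ] ℝ))
    (hu'_bdd : ∃ C : ℝ, ∀ t : ℝ, ‖u' t‖ ≤ C)
    (hu'_deriv : ∀ (φ : S.H) (t : ℝ), HasDerivAt (fun s => l2Pair S (u s) φ) (u' t φ) t)
    (heq : ∀ (t : ℝ) (φ : S.H),
      u' t ((-Complex.I) • φ) + deltaPair S (u t) φ
        - (∫ x, ((∫ y, W (x - y) * ‖(S.toL2 (u t)) y‖ ^ 2 ∂S.μ : ℝ) : ℂ)
            * ((S.toL2 (u t)) x * (starRingEnd ℂ) ((S.toL2 φ) x)) ∂S.μ).re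
      = 0) {M K : ℝ} (hM : ∀ t, ‖S.toL2 (u t)‖ = M) (hK : ∀ t, ‖S.grad (u t)‖ ≤ K) (t : ℝ) :
    |(∫ x, a x * ‖S.toL2 (u t) x‖ ^ 2 ∂(volume.restrict S.Ω)) -
      ∫ x, a x * ‖S.toL2 (u 0) x‖ ^ 2 ∂(volume.restrict S.Ω)| ≤ 2 * (L * K * M) * |t| := by
  have hM0 : 0 ≤ M := (norm_nonneg _).trans (hM 0).le
  rw [← l2Pair_cut_self S T, ← l2Pair_cut_self S T]
  have h := Convex.norm_image_sub_le_of_norm_hasDerivWithin_le (s := (Set.univ : Set ℝ))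
    (f := fun s => l2Pair S (u s) (T.A (u s))) (f' := fun s => 2 * u' s (T.A (u s)))
    (C := 2 * (L * K * M)) (x := 0) (y := t)
    (fun s _ => (hasDerivAt_m S T u hu_cont u' hu'_bdd hu'_deriv s).hasDerivWithinAt)
    (fun s _ => ?_) convex_univ (mem_univ _) (mem_univ _)
  · simpa using h
  · rw [norm_mul, Real.norm_two, Real.norm_eq_abs]
    have h1 := u'_cut S T (fun x => ∫ y, W (x - y) * ‖(S.toL2 (u s)) y‖ ^ 2 ∂S.μ) (u s) (u' s)
      (heq s)
    rw [hM] at h1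
    have h2 := hK s
    refine mul_le_mul_of_nonneg_left (h1.trans ?_) (by norm_num)
    gcongr

def tent (c : EucSp N) (R : ℝ) (x : EucSp N) : ℝ := max (1 - dist x c / R) 0

lemma tent_nonneg (c : EucSp N) (R : ℝ) (x : EucSp N) : 0 ≤ tent c R x := le_max_right _ _

lemma tent_le (c : EucSp N) {R : ℝ} (hR : 0 < R) (x : EucSp N) : tent c R x ≤ 1 := by
  refine max_le ?_ zero_le_one
  have : 0 ≤ dist x c / R := by positivity
  linarith

lemma tent_out (c : EucSp N) {R : ℝ} (hR : 0 < R) (x : EucSp N) (hx : x ∉ ball c R) :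
    tent c R x = 0 := by
  rw [mem_ball, not_lt] at hx
  refine max_eq_right ?_
  have : 1 ≤ dist x c / R := (one_le_div hR).2 hx
  linarith

lemma tent_lip (c : EucSp N) {R : ℝ} (hR : 0 < R) :
    LipschitzWith (Real.toNNReal (1 / R)) (tent c R) := by
  refine LipschitzWith.of_dist_le_mul fun x y => ?_
  rw [Real.coe_toNNReal _ (by positivity), Real.dist_eq]
  refine (abs_max_sub_max_le_abs _ _ _).trans ?_
  have : (1 - dist x c / R) - (1 - dist y c / R) = (1 / R) * (dist y c - dist x c) := by ring
  rw [this, abs_mul, abs_of_pos (by positivity : 0 < 1 / R)]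
  gcongr
  rw [dist_comm x y]
  exact abs_dist_sub_le y x c

lemma tent_int (S : DirichletSetting N) (c : EucSp N) {R : ℝ} (hR : 0 < R)
    (f : Lp ℂ 2 (volume.restrict S.Ω)) :
    Integrable (fun x => tent c R x * ‖f x‖ ^ 2) (volume.restrict S.Ω) := by
  refine (lp_int_sq f).mono
    ((tent_lip c hR).continuous.aestronglyMeasurable.mul (lp_int_sq f).1) (.of_forall fun x => ?_)
  rw [norm_mul, Real.norm_eq_abs, abs_of_nonneg (tent_nonneg c R x)]
  exact mul_le_of_le_one_left (norm_nonneg _) (tent_le c hR x)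

lemma tent_lim (S : DirichletSetting N) (c : EucSp N) (f : Lp ℂ 2 (volume.restrict S.Ω)) :
    Tendsto (fun R : ℝ => ∫ x, tent c R x * ‖f x‖ ^ 2 ∂(volume.restrict S.Ω)) atTop
      (𝓝 (‖f‖ ^ 2)) := by
  rw [lp_norm_sq]
  refine tendsto_integral_filter_of_dominated_convergence (fun x => ‖f x‖ ^ 2) ?_ ?_
    (lp_int_sq f) ?_
  · filter_upwards [eventually_gt_atTop 0] with R hR
    exact (tent_int S c hR f).1
  · filter_upwards [eventually_gt_atTop 0] with R hR
    refine .of_forall fun x => ?_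
    rw [norm_mul, Real.norm_eq_abs, abs_of_nonneg (tent_nonneg c R x), Real.norm_eq_abs,
      abs_of_nonneg (by positivity)]
    exact mul_le_of_le_one_left (by positivity) (tent_le c hR x)
  · refine .of_forall fun x => ?_
    have h1 : Tendsto (fun R : ℝ => 1 - dist x c / R) atTop (𝓝 (1 - 0)) :=
      tendsto_const_nhds.sub (tendsto_const_nhds.div_atTop tendsto_id)
    have h2 := h1.max (tendsto_const_nhds (x := (0 : ℝ)))
    have h3 := h2.mul_const (‖f x‖ ^ 2)
    simpa [tent] using h3

lemma tent_le_eLp (S : DirichletSetting N) (c : EucSp N) {R : ℝ} (hR : 0 < R)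
    (f : Lp ℂ 2 (volume.restrict S.Ω)) :
    ENNReal.ofReal (Real.sqrt (∫ x, tent c R x * ‖f x‖ ^ 2 ∂(volume.restrict S.Ω))) ≤
      eLpNorm f 2 (volume.restrict (S.Ω ∩ ball c R)) := by
  have hr : volume.restrict (S.Ω ∩ ball c R) = (volume.restrict S.Ω).restrict (ball c R) := by
    rw [Measure.restrict_restrict measurableSet_ball, Set.inter_comm]
  rw [hr, MemLp.eLpNorm_eq_integral_rpow_norm (by norm_num) (by norm_num)
    ((Lp.memLp f).restrict _)]
  refine ENNReal.ofReal_le_ofReal ?_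
  have h2 : (ENNReal.toReal 2)⁻¹ = (1 / 2 : ℝ) := by simp
  rw [h2, ← Real.sqrt_eq_rpow]
  refine Real.sqrt_le_sqrt ?_
  simp only [ENNReal.toReal_ofNat, Real.rpow_ofNat]
  rw [← integral_indicator measurableSet_ball]
  refine integral_mono (tent_int S c hR f) ((lp_int_sq f).indicator measurableSet_ball) fun x => ?_
  by_cases hx : x ∈ ball c R
  · simp only [Set.indicator_of_mem hx]
    exact mul_le_of_le_one_left (by positivity) (tent_le c hR x)
  · simp [Set.indicator_of_notMem hx, tent_out c hR x hx]

lemma holder_scaled (S : DirichletSetting N) (hμ : volume.restrict S.Ω = volume)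
    (c : EucSp N) {M₀ t : ℝ} (hM₀ : 0 < M₀) (ht : t ≠ 0) (r : ℝ≥0∞) (hr : 2 ≤ r)
    (f : Lp ℂ 2 (volume.restrict S.Ω)) :
    eLpNorm f 2 (volume.restrict (S.Ω ∩ ball c (M₀ * |t|))) *
        (volume (ball (0 : EucSp N) M₀)) ^ (-((1:ℝ)/2 - (1/r).toReal)) ≤
      ENNReal.ofReal (|t| ^ ((N : ℝ) * ((1:ℝ)/2 - (1/r).toReal))) *
        eLpNorm f r (volume.restrict (S.Ω ∩ ball c (M₀ * |t|))) := by
  have ht' : 0 < |t| := abs_pos.2 ht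
  set s : ℝ := (1:ℝ)/2 - (1/r).toReal with hs
  set V := volume (ball (0 : EucSp N) M₀) with hV
  have hs0 : 0 ≤ s := by
    have : (1 / r).toReal ≤ (1 / 2 : ℝ≥0∞).toReal := by
      refine ENNReal.toReal_mono (by simp) ?_
      exact ENNReal.div_le_div_left hr 1
    rw [hs]
    simp at this ⊢
    linarith
  have hV0 : V ≠ 0 := (measure_ball_pos volume 0 hM₀).ne'
  have hVt : V ≠ ⊤ := measure_ball_lt_top.ne
  have hball : volume (S.Ω ∩ ball c (M₀ * |t|)) = ENNReal.ofReal (|t| ^ N) * V := by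
    have h1 : volume (S.Ω ∩ ball c (M₀ * |t|)) = volume (ball c (M₀ * |t|)) := by
      conv_rhs => rw [← hμ]
      rw [Measure.restrict_apply measurableSet_ball, Set.inter_comm]
    rw [h1, mul_comm, Measure.addHaar_ball_mul_of_pos volume c ht' M₀]
    simp [hV]
  have hH := eLpNorm_le_eLpNorm_mul_rpow_measure_univ (f := f)
    (μ := volume.restrict (S.Ω ∩ ball c (M₀ * |t|))) hr
    ((Lp.aestronglyMeasurable f).mono_measure (Measure.restrict_mono Set.inter_subset_left le_rfl))
  have he : 1 / (2 : ℝ≥0∞).toReal - 1 / r.toReal = s := by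
    rw [hs]; simp
  have hpow : ENNReal.ofReal (|t| ^ N) ^ s = ENNReal.ofReal (|t| ^ ((N : ℝ) * s)) := by
    rw [ENNReal.ofReal_rpow_of_nonneg (by positivity) hs0, ← Real.rpow_natCast,
      ← Real.rpow_mul ht'.le]
  rw [he, Measure.restrict_apply_univ, hball, ENNReal.mul_rpow_of_nonneg _ _ hs0, hpow] at hH
  calc _ ≤ (eLpNorm f r (volume.restrict (S.Ω ∩ ball c (M₀ * |t|))) *
        (ENNReal.ofReal (|t| ^ ((N : ℝ) * s)) * V ^ s)) * V ^ (-s) := by gcongr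
    _ = ENNReal.ofReal (|t| ^ ((N : ℝ) * s)) *
        eLpNorm f r (volume.restrict (S.Ω ∩ ball c (M₀ * |t|))) * (V ^ s * V ^ (-s)) := by ring
    _ = _ := by
      rw [ENNReal.rpow_neg, ENNReal.mul_inv_cancel, mul_one]
      · exact (ENNReal.rpow_pos (pos_iff_ne_zero.2 hV0) hVt).ne'
      · exact ENNReal.rpow_ne_top_of_nonneg hs0 hVt

lemma liminf_bound (S : DirichletSetting N) (hμ : volume.restrict S.Ω = volume)
    (W : EucSp N → ℝ)
    (u : ℝ → S.H) (hu_cont : Continuous u)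
    (u' : ℝ → (S.H →L[ℝ] ℝ))
    (hu'_bdd : ∃ C : ℝ, ∀ t : ℝ, ‖u' t‖ ≤ C)
    (hu'_deriv : ∀ (φ : S.H) (t : ℝ), HasDerivAt (fun s => l2Pair S (u s) φ) (u' t φ) t)
    (heq : ∀ (t : ℝ) (φ : S.H),
      u' t ((-Complex.I) • φ) + deltaPair S (u t) φ
        - (∫ x, ((∫ y, W (x - y) * ‖(S.toL2 (u t)) y‖ ^ 2 ∂S.μ : ℝ) : ℂ)
            * ((S.toL2 (u t)) x * (starRingEnd ℂ) ((S.toL2 φ) x)) ∂S.μ).re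
      = 0) {M K ε M₀ : ℝ} (hM : ∀ t, ‖S.toL2 (u t)‖ = M) (hK : ∀ t, ‖S.grad (u t)‖ ≤ K)
    (hK0 : 0 < K) (hε0 : 0 < ε) (hε : ε < M) (hM₀ : M₀ = 2 * M * K / (M ^ 2 - ε ^ 2))
    (l : Filter ℝ) [l.NeBot] (hl : Tendsto (fun t : ℝ => |t|) l atTop)
    (r : ℝ≥0∞) (hr : 2 ≤ r) (c : EucSp N) :
    (ENNReal.ofReal ε * (volume (Metric.ball (0 : EucSp N) M₀)) ^ (-((1:ℝ)/2 - (1/r).toReal))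
      ≤ Filter.liminf (fun t : ℝ =>
          ENNReal.ofReal (|t| ^ ((N : ℝ) * ((1:ℝ)/2 - (1/r).toReal))) *
            eLpNorm (S.toL2 (u t)) r (volume.restrict (S.Ω ∩ Metric.ball c (M₀ * |t|)))) l) := by
  have hMp : 0 < M := hε0.trans hε
  have hd : 0 < M ^ 2 - ε ^ 2 := by nlinarith
  have hM₀p : 0 < M₀ := by rw [hM₀]; positivity
  set s : ℝ := (1:ℝ)/2 - (1/r).toReal with hs
  set V := volume (ball (0 : EucSp N) M₀) with hV
  have hV0 : V ≠ 0 := (measure_ball_pos volume 0 hM₀p).ne'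
  have hVt : V ≠ ⊤ := measure_ball_lt_top.ne
  have hVs : V ^ (-s) ≠ ⊤ := ENNReal.rpow_ne_top_of_ne_zero hV0 hVt
  let J : ℝ → ℝ := fun R => ∫ x, tent c R x * ‖S.toL2 (u 0) x‖ ^ 2 ∂(volume.restrict S.Ω)
  have hJ : Tendsto (fun t : ℝ => J (M₀ * |t|)) l (𝓝 (M ^ 2)) := by
    have h1 := tent_lim S c (S.toL2 (u 0))
    rw [hM] at h1
    exact h1.comp (hl.const_mul_atTop hM₀p)
  have hF : Tendsto (fun t : ℝ =>
      ENNReal.ofReal (Real.sqrt (J (M₀ * |t|) - (M ^ 2 - ε ^ 2))) * V ^ (-s)) l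
      (𝓝 (ENNReal.ofReal ε * V ^ (-s))) := by
    refine ENNReal.Tendsto.mul_const ?_ (Or.inr hVs)
    refine ENNReal.tendsto_ofReal ?_
    have h2 := (hJ.sub_const (M ^ 2 - ε ^ 2)).sqrt
    rwa [_root_.sub_sub_cancel, Real.sqrt_sq hε0.le] at h2
  rw [← hF.liminf_eq]
  refine liminf_le_liminf ?_
  filter_upwards [hl.eventually (eventually_gt_atTop 0)] with t ht
  have hR : 0 < M₀ * |t| := by positivity
  obtain ⟨T⟩ := exists_cutOp S hμ (tent_lip c hR) (B := 1) (fun x => by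
    rw [abs_of_nonneg (tent_nonneg _ _ _)]; exact tent_le c hR x)
  have hb := m_bound S (NNReal.coe_nonneg _) T W u hu_cont u' hu'_bdd hu'_deriv heq hM hK t
  rw [Real.coe_toNNReal _ (by positivity)] at hb
  have hc : 2 * (1 / (M₀ * |t|) * K * M) * |t| = M ^ 2 - ε ^ 2 := by
    rw [hM₀]; field_simp
  rw [hc] at hb
  have hb' := (abs_le.1 hb).1
  refine le_trans ?_ (holder_scaled S hμ c hM₀p (abs_pos.1 ht) r hr (S.toL2 (u t)))
  gcongr
  refine le_trans (ENNReal.ofReal_le_ofReal (Real.sqrt_le_sqrt ?_))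
    (tent_le_eLp S c hR (S.toL2 (u t)))
  simp only [J]
  linarith


/-- **The Hartree type nonlinearity (Bégout, Example 3.3).**
Let `Ω = ℝ^N`, `W : ℝ^N → ℝ` with `W ∈ L^p(ℝ^N) + L^∞(ℝ^N)` for some `p ≥ 1`,
`p > N/4`, and `W⁻ ∈ L^q(ℝ^N) + L^∞(ℝ^N)` for some `q ≥ 1`, `q ≥ N/2` (`q > 1` if
`N = 2`). Let `u₀ ∈ H¹(ℝ^N) \ {0}` and `u ∈ C_b(ℝ;H¹(ℝ^N)) ∩ C¹_b(ℝ;H⁻¹(ℝ^N))` be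
the solution of `i∂ₜu + Δu - (W∗|u|²)u = 0`, `u(0) = u₀`, satisfying conservation
of charge and of the energy
`E(u₀) = (1/2)‖∇u₀‖²_{L²} + (1/4)∫(W∗|u₀|²)|u₀|²`. Then for every
`0 < ε < ‖u₀‖_{L²}`, with `M₀ = 2‖u₀‖_{L²}‖∇u‖_{L^∞(ℝ;L²)}/(‖u₀‖²_{L²} - ε²)`, for
every `c ∈ ℝ^N` and `r ∈ [2,∞]`:
`liminf_{t→±∞} |t|^{N(1/2-1/r)} ‖u(t)‖_{L^r({|x-c|<M₀|t|})} ≥ ε |B(0,M₀)|^{-(1/2-1/r)}`;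
and if moreover `W ≥ 0`, the same holds with
`M₀ = 2‖u₀‖_{L²}√(2E(u₀))/(‖u₀‖²_{L²} - ε²)`. -/
theorem hartree_lower_bound (N : ℕ) (hN : 1 ≤ N) (S : DirichletSetting N)
    (hΩ : S.Ω = Set.univ) (W : EucSp N → ℝ)
    (hW : ∃ p : ℝ, 1 ≤ p ∧ (N : ℝ) / 4 < p ∧ ∃ W₁ W₂ : EucSp N → ℝ,
      W = W₁ + W₂ ∧ MemLp W₁ (ENNReal.ofReal p) volume ∧ MemLp W₂ ⊤ volume)
    (hWneg : ∃ q : ℝ, 1 ≤ q ∧ (N : ℝ) / 2 ≤ q ∧ (N = 2 → 1 < q) ∧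
      ∃ W₁ W₂ : EucSp N → ℝ, (fun x => max (-W x) 0) = W₁ + W₂ ∧
        MemLp W₁ (ENNReal.ofReal q) volume ∧ MemLp W₂ ⊤ volume)
    (u₀ : S.H) (hu₀ : u₀ ≠ 0) (u : ℝ → S.H) (hu0 : u 0 = u₀)
    (hu_cont : Continuous u) (hu_bdd : ∃ C : ℝ, ∀ t : ℝ, ‖u t‖ ≤ C)
    (u' : ℝ → (S.H →L[ℝ] ℝ))
    (hu'_cont : ∀ φ : S.H, Continuous fun t => u' t φ)
    (hu'_bdd : ∃ C : ℝ, ∀ t : ℝ, ‖u' t‖ ≤ C)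
    (hu'_deriv : ∀ (φ : S.H) (t : ℝ), HasDerivAt (fun s => l2Pair S (u s) φ) (u' t φ) t)
    (heq : ∀ (t : ℝ) (φ : S.H),
      u' t ((-Complex.I) • φ) + deltaPair S (u t) φ
        - (∫ x, ((∫ y, W (x - y) * ‖(S.toL2 (u t)) y‖ ^ 2 ∂S.μ : ℝ) : ℂ)
            * ((S.toL2 (u t)) x * (starRingEnd ℂ) ((S.toL2 φ) x)) ∂S.μ).re
      = 0)
    (hcharge : ∀ t : ℝ, ‖S.toL2 (u t)‖ = ‖S.toL2 u₀‖)
    (henergy : ∀ t : ℝ, hartreeEnergy S W (u t) = hartreeEnergy S W u₀)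
    (ε : ℝ) (hε0 : 0 < ε) (hε : ε < ‖S.toL2 u₀‖) :
    (∀ M₀ : ℝ,
      M₀ = 2 * ‖S.toL2 u₀‖ * gradSup S u Set.univ / (‖S.toL2 u₀‖ ^ 2 - ε ^ 2) →
      lowerBoundTwoSided S u ε M₀) ∧
    ((∀ x : EucSp N, 0 ≤ W x) → ∀ M₀ : ℝ,
      M₀ = 2 * ‖S.toL2 u₀‖ * Real.sqrt (2 * hartreeEnergy S W u₀)
        / (‖S.toL2 u₀‖ ^ 2 - ε ^ 2) →
      lowerBoundTwoSided S u ε M₀) := by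
  have hμ : volume.restrict S.Ω = (volume : Measure (EucSp N)) := by
    rw [hΩ, Measure.restrict_univ]
  have hg0 : 0 < ‖S.grad (u 0)‖ := by
    rw [hu0]
    exact norm_pos_iff.2 fun h => hu₀ (grad_ne_zero hN S hμ u₀ h)
  have main : ∀ K : ℝ, (∀ t, ‖S.grad (u t)‖ ≤ K) → ∀ M₀ : ℝ,
      M₀ = 2 * ‖S.toL2 u₀‖ * K / (‖S.toL2 u₀‖ ^ 2 - ε ^ 2) → lowerBoundTwoSided S u ε M₀ := by
    intro K hK M₀ hM₀ r hr c _
    have hK0 : 0 < K := hg0.trans_le (hK 0)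
    exact ⟨liminf_bound S hμ W u hu_cont u' hu'_bdd hu'_deriv heq hcharge hK hK0 hε0 hε hM₀
        atTop tendsto_abs_atTop_atTop r hr c,
      liminf_bound S hμ W u hu_cont u' hu'_bdd hu'_deriv heq hcharge hK hK0 hε0 hε hM₀
        atBot tendsto_abs_atBot_atTop r hr c⟩
  refine ⟨main _ fun t => ?_, fun hW0 => main _ fun t => ?_⟩
  · obtain ⟨C, hC⟩ := hu_bdd
    refine le_csSup ⟨C, ?_⟩ (mem_image_of_mem _ (mem_univ t))
    rintro _ ⟨s, -, rfl⟩
    exact (norm_grad_le S (u s)).trans (hC s)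
  · refine Real.le_sqrt_of_sq_le ?_
    rw [← henergy t]
    unfold hartreeEnergy
    have : 0 ≤ ∫ x, (∫ y, W (x - y) * ‖(S.toL2 (u t)) y‖ ^ 2 ∂S.μ) * ‖(S.toL2 (u t)) x‖ ^ 2 ∂S.μ :=
      integral_nonneg fun x => mul_nonneg
        (integral_nonneg fun y => mul_nonneg (hW0 _) (by positivity)) (by positivity)
    linarith

end
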